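/- Let H be a complex inner product space, n a natural number, (e_i)_{i < n} an orthonormal family in H, and (v_i)_{i < n} a family of vectors with Σ_{i < n} ‖v_i − e_i‖² < 1. Then the family (v_i)_{i < n} is linearly independent. -/

import Mathlib

/-- Pythagoras for a finite linear combination of an orthonormal family. -/
theorem Orthonormal.norm_sq_sum_smul {𝕜 E ι : Type*} [RCLike 𝕜] [SeminormedAddCommGroup E]
    [InnerProductSpace 𝕜 E] [Fintype ι] {e : ι → E} (he : Orthonormal 𝕜 e) (g : ι → 𝕜) :
    ‖∑ i, g i • e i‖ ^ 2 = ∑ i, ‖g i‖ ^ 2 := by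
  have h := he.inner_sum g g Finset.univ
  rw [inner_self_eq_norm_sq_to_K] at h
  simp only [RCLike.conj_mul] at h
  exact_mod_cast h

/-- Cauchy–Schwarz bound for the norm of a finite linear combination. -/
theorem norm_sq_sum_smul_le {𝕜 E ι : Type*} [NormedField 𝕜] [SeminormedAddCommGroup E]
    [NormedSpace 𝕜 E] [Fintype ι] (g : ι → 𝕜) (w : ι → E) :
    ‖∑ i, g i • w i‖ ^ 2 ≤ (∑ i, ‖g i‖ ^ 2) * ∑ i, ‖w i‖ ^ 2 := by
  calc ‖∑ i, g i • w i‖ ^ 2 ≤ (∑ i, ‖g i‖ * ‖w i‖) ^ 2 := by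
        gcongr
        exact norm_sum_le_of_le _ fun i _ => norm_smul_le _ _
    _ ≤ _ := Finset.sum_mul_sq_le_sq_mul_sq _ _ _

/-- A family of vectors close to an orthonormal family (in the sense that
`Σ ‖vᵢ − eᵢ‖² < 1`) is linearly independent. -/
theorem linearIndependent_of_close_to_orthonormal {H : Type*}
    [NormedAddCommGroup H] [InnerProductSpace ℂ H] (n : ℕ)
    (e : Fin n → H) (he : Orthonormal ℂ e) (v : Fin n → H)
    (hv : ∑ i : Fin n, ‖v i - e i‖ ^ 2 < 1) :
    LinearIndependent ℂ v := by
  rw [Fintype.linearIndependent_iff]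
  intro g hg
  have hle := norm_sq_sum_smul_le g (fun i => v i - e i)
  simp only [smul_sub, Finset.sum_sub_distrib, hg, zero_sub, norm_neg,
    he.norm_sq_sum_smul] at hle
  have hnonneg : ∀ i ∈ Finset.univ, 0 ≤ ‖g i‖ ^ 2 := fun i _ => sq_nonneg _
  have hzero : ∑ i, ‖g i‖ ^ 2 = 0 := by
    nlinarith [Finset.sum_nonneg hnonneg]
  intro i
  simpa using (Finset.sum_eq_zero_iff_of_nonneg hnonneg).mp hzero i (Finset.mem_univ i)
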